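/- arXiv:2312.08135 — 4 statements merged into one kernel-verified Lean document; each statement's English description precedes it below -/
import Mathlib

section
/- Assume Assumption 1 and that θ̄ ∈ L²(ℝ^d; ℝ^m; μ). For every τ > 0, the infimum over all pairs (π, π̃), where π is a Borel probability measure on ℝ^d × ℝ^m with first marginal μ, π̃ is a Borel probability measure on ℝ^m × ℝ^m with second marginal G*, and the second marginal of π equals the first marginal of π̃, of the quantity ∫|θ̄(z) − θ̃|² dπ(z, θ̃) + (1/(2τ)) ∫|θ̃ − θ|² dπ̃(θ̃, θ), equals the infimum over γ ∈ Γ(μ, G*) of ∫ B(z,θ) dγ(z,θ), where B(z,θ) := (1/(1+2τ)) |θ̄(z) − θ|². -/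
open MeasureTheory ProbabilityTheory Filter RealInnerProductSpace
open scoped ENNReal

noncomputable section

/-- Euclidean space `ℝ^n`. -/
abbrev Vec (n : ℕ) := EuclideanSpace ℝ (Fin n)

/-- `π` is a coupling of `ν₁` and `ν₂`: a measure on the product whose marginals are
`ν₁` and `ν₂`. -/
def IsCoupling {X Y : Type*} [MeasurableSpace X] [MeasurableSpace Y]
    (π : Measure (X × Y)) (ν₁ : Measure X) (ν₂ : Measure Y) : Prop :=
  π.map Prod.fst = ν₁ ∧ π.map Prod.snd = ν₂

/-- Squared 2-Wasserstein distance between Borel measures on `ℝ^n`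
(as an extended nonnegative real). -/
def W2sq {n : ℕ} (ν₁ ν₂ : Measure (Vec n)) : ℝ≥0∞ :=
  ⨅ π ∈ {π : Measure (Vec n × Vec n) | IsCoupling π ν₁ ν₂},
    ∫⁻ p, ENNReal.ofReal (‖p.1 - p.2‖ ^ 2) ∂π

/-- `θbar` is a Borel version of the posterior mean `E[Θ | Z]` under the joint law `P`. -/
def IsPosteriorMean {d m : ℕ} (P : Measure (Vec d × Vec m)) (θbar : Vec d → Vec m) : Prop :=
  Measurable θbar ∧
  (fun p => θbar p.1) =ᵐ[P]
    P[(fun p : Vec d × Vec m => p.2) | MeasurableSpace.comap Prod.fst inferInstance]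

lemma aux_ineq {m : ℕ} (τ : ℝ) (hτ : 0 < τ) (a x b : Vec m) :
    (1 / (1 + 2 * τ)) * ‖a - b‖ ^ 2 ≤ ‖a - x‖ ^ 2 + (1 / (2 * τ)) * ‖x - b‖ ^ 2 := by
  have h : ‖a - b‖ ≤ ‖a - x‖ + ‖x - b‖ := norm_sub_le_norm_sub_add_norm_sub a x b
  have h2 : ‖a - b‖ ^ 2 ≤ (‖a - x‖ + ‖x - b‖) ^ 2 := by gcongr
  set u := ‖a - x‖
  set v := ‖x - b‖
  have h3 : u ^ 2 + (1 / (2 * τ)) * v ^ 2 - (1 / (1 + 2 * τ)) * (u + v) ^ 2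
      = (2 * τ * u - v) ^ 2 / ((2 * τ) * (1 + 2 * τ)) := by
    field_simp
    ring
  have h4 : 0 ≤ (2 * τ * u - v) ^ 2 / ((2 * τ) * (1 + 2 * τ)) := by positivity
  have h5 : (1 / (1 + 2 * τ)) * ‖a - b‖ ^ 2 ≤ (1 / (1 + 2 * τ)) * (u + v) ^ 2 := by gcongr
  linarith

lemma aux_eq {m : ℕ} (τ : ℝ) (hτ : 0 < τ) (a b : Vec m) :
    ‖a - ((2 * τ / (1 + 2 * τ)) • a + (1 / (1 + 2 * τ)) • b)‖ ^ 2 +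
      (1 / (2 * τ)) * ‖((2 * τ / (1 + 2 * τ)) • a + (1 / (1 + 2 * τ)) • b) - b‖ ^ 2
      = (1 / (1 + 2 * τ)) * ‖a - b‖ ^ 2 := by
  have hne : (1 + 2 * τ) ≠ 0 := by positivity
  have e1 : a - ((2 * τ / (1 + 2 * τ)) • a + (1 / (1 + 2 * τ)) • b)
      = (1 / (1 + 2 * τ)) • (a - b) := by
    match_scalars
    · field_simp
      ring
    · ring
  have e2 : ((2 * τ / (1 + 2 * τ)) • a + (1 / (1 + 2 * τ)) • b) - b
      = (2 * τ / (1 + 2 * τ)) • (a - b) := by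
    match_scalars
    · ring
    · field_simp
      ring
  rw [e1, e2, norm_smul, norm_smul, mul_pow, mul_pow, Real.norm_eq_abs, Real.norm_eq_abs,
    sq_abs, sq_abs]
  field_simp

lemma exists_glue {X Y Z : Type*} [MeasurableSpace X] [MeasurableSpace Y] [MeasurableSpace Z]
    [StandardBorelSpace Z] [Nonempty Z]
    (π : Measure (X × Y)) (ρ : Measure (Y × Z)) [IsProbabilityMeasure π] [IsProbabilityMeasure ρ]
    (h : π.map Prod.snd = ρ.map Prod.fst) :
    ∃ ω : Measure ((X × Y) × Z), ω.map Prod.fst = π ∧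
      ω.map (fun p => (p.1.2, p.2)) = ρ := by
  refine ⟨π ⊗ₘ (ρ.condKernel.comap Prod.snd measurable_snd), ?_, ?_⟩
  · exact Measure.fst_compProd _ _
  · have hρ : (π.map Prod.snd) ⊗ₘ ρ.condKernel = ρ := by
      rw [h]; exact ρ.disintegrate ρ.condKernel
    have : IsProbabilityMeasure (π.map Prod.snd) :=
      Measure.isProbabilityMeasure_map measurable_snd.aemeasurable
    conv_rhs => rw [← hρ]
    have hm : Measurable (fun p : (X × Y) × Z => (p.1.2, p.2)) := by fun_prop
    refine Measure.ext_of_lintegral _ fun f hf => ?_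
    rw [lintegral_map hf hm, Measure.lintegral_compProd (f := fun a : (X × Y) × Z => f (a.1.2, a.2)) (hf.comp hm),
      Measure.lintegral_compProd hf,
      lintegral_map hf.lintegral_kernel_prod_right' measurable_snd]
    rfl

/-- The relaxed two-coupling problem has the same value as the barycenter
problem: the infimum over pairs `(π, π̃)` with `π₁ = μ`, `π̃₂ = G*`, `π₂ = π̃₁` of
`∫‖θ̄(z) − θ̃‖² dπ + (1/(2τ)) ∫‖θ̃ − θ‖² dπ̃` equals the infimum over `γ ∈ Γ(μ, G*)` of
`∫ B(z,θ) dγ` with `B(z,θ) = (1/(1+2τ))‖θ̄(z) − θ‖²`. -/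
theorem stmt12 {d m : ℕ}
    (P : Measure (Vec d × Vec m)) [IsProbabilityMeasure P]
    (μ : Measure (Vec d)) (G : Measure (Vec m))
    (hμ : μ = P.map Prod.fst) (hG : G = P.map Prod.snd)
    (θbar : Vec d → Vec m) (hθbar : IsPosteriorMean P θbar)
    -- Assumption 1 and square-integrability of `θ̄`
    (hA1 : ∫⁻ θ, ENNReal.ofReal (‖θ‖ ^ 2) ∂G < ⊤)
    (hθL2 : MemLp θbar 2 μ)
    (τ : ℝ) (hτ : 0 < τ) :
    (⨅ pp ∈ {pp : Measure (Vec d × Vec m) × Measure (Vec m × Vec m) |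
        IsProbabilityMeasure pp.1 ∧ IsProbabilityMeasure pp.2 ∧
        pp.1.map Prod.fst = μ ∧ pp.2.map Prod.snd = G ∧
        pp.1.map Prod.snd = pp.2.map Prod.fst},
      (∫⁻ p, ENNReal.ofReal (‖θbar p.1 - p.2‖ ^ 2) ∂pp.1) +
        ENNReal.ofReal (1 / (2 * τ)) * ∫⁻ q, ENNReal.ofReal (‖q.1 - q.2‖ ^ 2) ∂pp.2) =
    ⨅ γ ∈ {γ : Measure (Vec d × Vec m) | IsCoupling γ μ G},
      ∫⁻ p, ENNReal.ofReal ((1 / (1 + 2 * τ)) * ‖θbar p.1 - p.2‖ ^ 2) ∂γ := by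
  have hθ : Measurable θbar := hθbar.1
  have hc : (0 : ℝ) ≤ 1 / (2 * τ) := by positivity
  apply le_antisymm
  · refine le_iInf₂ fun γ hγ => ?_
    obtain ⟨h1, h2⟩ := hγ
    have hμp : IsProbabilityMeasure μ := by
      rw [hμ]; exact Measure.isProbabilityMeasure_map measurable_fst.aemeasurable
    have hγp : IsProbabilityMeasure γ := by
      constructor
      have : μ Set.univ = 1 := measure_univ
      rwa [← h1, Measure.map_apply measurable_fst MeasurableSet.univ, Set.preimage_univ] at this
    let T : Vec d × Vec m → Vec m := fun p =>
      (2 * τ / (1 + 2 * τ)) • θbar p.1 + (1 / (1 + 2 * τ)) • p.2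
    have hT : Measurable T := by fun_prop
    have hA : Measurable (fun p : Vec d × Vec m => (p.1, T p)) := by fun_prop
    have hB : Measurable (fun p : Vec d × Vec m => (T p, p.2)) := by fun_prop
    refine (iInf₂_le (γ.map (fun p => (p.1, T p)), γ.map (fun p => (T p, p.2)))
      ⟨Measure.isProbabilityMeasure_map hA.aemeasurable,
        Measure.isProbabilityMeasure_map hB.aemeasurable, ?_, ?_, ?_⟩).trans ?_
    rotate_left
    · dsimp only
      rw [Measure.map_map measurable_fst hA]; exact h1
    · dsimp only
      rw [Measure.map_map measurable_snd hB]; exact h2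
    · dsimp only
      rw [Measure.map_map measurable_snd hA, Measure.map_map measurable_fst hB]; rfl
    · dsimp only
      rw [lintegral_map (by fun_prop) hA, lintegral_map (by fun_prop) hB,
        ← lintegral_const_mul _ (by fun_prop), ← lintegral_add_left (by fun_prop)]
      refine le_of_eq (lintegral_congr fun p => ?_)
      rw [← ENNReal.ofReal_mul hc, ← ENNReal.ofReal_add (by positivity) (by positivity)]
      exact congrArg _ (aux_eq τ hτ (θbar p.1) p.2)
  · refine le_iInf₂ fun pp hpp => ?_
    obtain ⟨π, ρ⟩ := pp
    obtain ⟨hp1, hp2, h1, h2, h3⟩ := hpp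
    dsimp only at hp1 hp2 h1 h2 h3 ⊢
    obtain ⟨ω, hω1, hω2⟩ := exists_glue π ρ h3
    have hA : Measurable (fun p : (Vec d × Vec m) × Vec m => (p.1.2, p.2)) := by fun_prop
    have hB : Measurable (fun p : (Vec d × Vec m) × Vec m => (p.1.1, p.2)) := by fun_prop
    refine (iInf₂_le (ω.map (fun p => (p.1.1, p.2))) ⟨?_, ?_⟩).trans ?_
    rotate_left
    · rw [← h1, ← hω1, Measure.map_map measurable_fst hB,
        Measure.map_map measurable_fst measurable_fst]; rfl
    · rw [← h2, ← hω2, Measure.map_map measurable_snd hB, Measure.map_map measurable_snd hA]; rfl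
    · rw [← hω1, ← hω2, lintegral_map (by fun_prop) hB, lintegral_map (by fun_prop) hA,
        lintegral_map (by fun_prop) measurable_fst,
        ← lintegral_const_mul _ (by fun_prop), ← lintegral_add_left (by fun_prop)]
      refine lintegral_mono fun p => ?_
      dsimp only
      rw [← ENNReal.ofReal_mul hc, ← ENNReal.ofReal_add (by positivity) (by positivity)]
      exact ENNReal.ofReal_le_ofReal (aux_ineq τ hτ _ _ _)

end
end

section
/- Under Assumptions 1 and 2, for every τ > 0 the pair (π*, π̃*), where π* := (Id × δ*_τ)♯μ and π̃* := (δ*_τ × δ*)♯μ with δ*_τ := (2τ/(1+2τ)) θ̄ + (1/(1+2τ)) δ*, is the unique solution of the relaxed two-coupling problem: it minimizes ∫|θ̄(z) − θ̃|² dπ(z, θ̃) + (1/(2τ)) ∫|θ̃ − θ|² dπ̃(θ̃, θ) over all pairs (π, π̃) of Borel probability measures on ℝ^d × ℝ^m and ℝ^m × ℝ^m respectively, with first marginal of π equal to μ, second marginal of π̃ equal to G*, and second marginal of π equal to the first marginal of π̃. -/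
open MeasureTheory ProbabilityTheory Filter RealInnerProductSpace
open scoped ENNReal

noncomputable section

/-- Optimal couplings are pairwise monotone. -/
lemma aux_swap {d m : ℕ} (μ : Measure (Vec d)) (G : Measure (Vec m))
    (θbar : Vec d → Vec m) (hθ : Measurable θbar)
    (π : Measure (Vec d × Vec m)) [IsProbabilityMeasure π] (hπ : IsCoupling π μ G)
    (hfin : ∫⁻ p, ENNReal.ofReal (‖θbar p.1 - p.2‖ ^ 2) ∂π ≠ ⊤)
    (hmin : ∀ π' : Measure (Vec d × Vec m), IsCoupling π' μ G →
      ∫⁻ p, ENNReal.ofReal (‖θbar p.1 - p.2‖ ^ 2) ∂π ≤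
        ∫⁻ p, ENNReal.ofReal (‖θbar p.1 - p.2‖ ^ 2) ∂π') :
    ∀ᵐ q ∂(π.prod π), 0 ≤ (inner ℝ (θbar q.1.1 - θbar q.2.1) (q.1.2 - q.2.2) : ℝ) := by
  set Q := π.prod π with hQ
  set c : Vec d × Vec m → ℝ≥0∞ := fun p => ENNReal.ofReal (‖θbar p.1 - p.2‖ ^ 2) with hc
  have hcm : Measurable c := by
    have : Measurable fun p : Vec d × Vec m => θbar p.1 - p.2 :=
      (hθ.comp measurable_fst).sub measurable_snd
    exact (this.norm.pow_const 2).ennreal_ofReal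
  set A : Set ((Vec d × Vec m) × (Vec d × Vec m)) :=
    {q | (inner ℝ (θbar q.1.1 - θbar q.2.1) (q.1.2 - q.2.2) : ℝ) < 0} with hA
  have hinm : Measurable fun q : (Vec d × Vec m) × (Vec d × Vec m) =>
      (inner ℝ (θbar q.1.1 - θbar q.2.1) (q.1.2 - q.2.2) : ℝ) := by
    refine Measurable.inner ?_ ?_
    · exact (hθ.comp (measurable_fst.comp measurable_fst)).sub
        (hθ.comp (measurable_fst.comp measurable_snd))
    · exact (measurable_snd.comp measurable_fst).sub (measurable_snd.comp measurable_snd)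
  have hAm : MeasurableSet A := measurableSet_lt hinm measurable_const
  have hsymm : ∀ q, q.swap ∈ A ↔ q ∈ A := by
    intro q
    simp only [hA, Set.mem_ofPred_eq, Prod.fst_swap, Prod.snd_swap]
    rw [← neg_sub (θbar q.1.1), ← neg_sub q.1.2, inner_neg_neg]
  -- symmetry of set integrals
  have hsw : ∀ f : (Vec d × Vec m) × (Vec d × Vec m) → ℝ≥0∞, 
      ∫⁻ q in A, f q.swap ∂Q = ∫⁻ q in A, f q ∂Q := by
    intro f
    rw [← lintegral_indicator hAm, ← lintegral_indicator hAm, hQ,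
      ← lintegral_prod_swap (A.indicator f)]
    refine lintegral_congr fun q => ?_
    by_cases h : q ∈ A
    · rw [Set.indicator_of_mem h, Set.indicator_of_mem ((hsymm q).2 h)]
    · rw [Set.indicator_of_notMem h, Set.indicator_of_notMem (fun h' => h ((hsymm q).1 h'))]
  classical
  set T : (Vec d × Vec m) × (Vec d × Vec m) → Vec d × Vec m :=
    fun q => if q ∈ A then (q.1.1, q.2.2) else q.1 with hT
  have hTm : Measurable T := by
    refine Measurable.ite hAm ?_ measurable_fst
    fun_prop
  have hmarg1 : Q.map Prod.fst = π := by
    rw [hQ]; simp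
  have hsplit : ∀ f : Vec d × Vec m → ℝ≥0∞, Measurable f →
      ∫⁻ p, f p ∂(Q.map T) = ∫⁻ q in A, f (q.1.1, q.2.2) ∂Q + ∫⁻ q in Aᶜ, f q.1 ∂Q := by
    intro f hf
    rw [lintegral_map hf hTm, ← lintegral_add_compl _ hAm]
    congr 1
    · refine setLIntegral_congr_fun hAm fun q hq => ?_
      simp only [hT, if_pos hq]
    · refine setLIntegral_congr_fun hAm.compl fun q hq => ?_
      simp only [hT, if_neg hq]
  have hsplit0 : ∀ f : Vec d × Vec m → ℝ≥0∞, Measurable f →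
      ∫⁻ p, f p ∂π = ∫⁻ q in A, f q.1 ∂Q + ∫⁻ q in Aᶜ, f q.1 ∂Q := by
    intro f hf
    rw [lintegral_add_compl _ hAm, ← lintegral_map hf measurable_fst, hmarg1]
  have hcoup : IsCoupling (Q.map T) μ G := by
    constructor
    · rw [← hπ.1]
      refine Measure.ext_of_lintegral _ fun f hf => ?_
      rw [lintegral_map hf measurable_fst, lintegral_map hf measurable_fst,
        hsplit (fun a => f a.1) (hf.comp measurable_fst),
        hsplit0 (fun a => f a.1) (hf.comp measurable_fst)]
    · rw [← hπ.2]
      refine Measure.ext_of_lintegral _ fun f hf => ?_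
      rw [lintegral_map hf measurable_snd, lintegral_map hf measurable_snd,
        hsplit (fun a => f a.2) (hf.comp measurable_snd),
        hsplit0 (fun a => f a.2) (hf.comp measurable_snd)]
      congr 1
      exact hsw (fun q => f q.1.2)
  have h1 := hmin _ hcoup
  change ∫⁻ p, c p ∂π ≤ ∫⁻ p, c p ∂(Q.map T) at h1
  have hfin' : ∫⁻ p, c p ∂π ≠ ⊤ := hfin
  rw [hsplit _ hcm, hsplit0 _ hcm] at h1
  rw [hsplit0 _ hcm] at hfin'
  have h2 := (ENNReal.add_le_add_iff_right (ENNReal.add_ne_top.1 hfin').2).1 h1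
  have hf1 := (ENNReal.add_ne_top.1 hfin').1
  have e1 : ∫⁻ q in A, c q.2 ∂Q = ∫⁻ q in A, c q.1 ∂Q := hsw (fun q => c q.1)
  have e2 : ∫⁻ q in A, c (q.2.1, q.1.2) ∂Q = ∫⁻ q in A, c (q.1.1, q.2.2) ∂Q :=
    hsw (fun q => c (q.1.1, q.2.2))
  have key : ∀ q ∈ A, c (q.1.1, q.2.2) + c (q.2.1, q.1.2) < c q.1 + c q.2 := by
    intro q hq
    simp only [hc]
    rw [← ENNReal.ofReal_add (by positivity) (by positivity),
      ← ENNReal.ofReal_add (by positivity) (by positivity)]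
    have hq' : (inner ℝ (θbar q.1.1 - θbar q.2.1) (q.1.2 - q.2.2) : ℝ) < 0 := hq
    simp only [inner_sub_left, inner_sub_right] at hq'
    have hlt : ‖θbar q.1.1 - q.2.2‖ ^ 2 + ‖θbar q.2.1 - q.1.2‖ ^ 2
        < ‖θbar q.1.1 - q.1.2‖ ^ 2 + ‖θbar q.2.1 - q.2.2‖ ^ 2 := by
      simp only [@norm_sub_sq_real]
      linarith
    exact (ENNReal.ofReal_lt_ofReal_iff (lt_of_le_of_lt (by positivity) hlt)).2 hlt
  have hm12 : Measurable fun q : (Vec d × Vec m) × (Vec d × Vec m) => c (q.1.1, q.2.2) :=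
    hcm.comp (by fun_prop)
  have hm1 : Measurable fun q : (Vec d × Vec m) × (Vec d × Vec m) => c q.1 :=
    hcm.comp measurable_fst
  by_contra hcon
  have hA0 : Q A ≠ 0 := by
    intro h0
    apply hcon
    rw [ae_iff]
    simpa [hA] using h0
  have hsum : ∫⁻ q in A, (c q.1 + c q.2) ∂Q ≠ ⊤ := by
    rw [lintegral_add_left hm1, e1]
    exact ENNReal.add_ne_top.2 ⟨hf1, hf1⟩
  have hle : ∫⁻ q in A, (c (q.1.1, q.2.2) + c (q.2.1, q.1.2)) ∂Q
      ≤ ∫⁻ q in A, (c q.1 + c q.2) ∂Q :=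
    setLIntegral_mono' hAm fun q hq => (key q hq).le
  have hlt := setLIntegral_strict_mono (μ := Q) hAm hA0
    (f := fun q => c (q.1.1, q.2.2) + c (q.2.1, q.1.2)) (g := fun q => c q.1 + c q.2)
    ((hcm.comp measurable_fst).add (hcm.comp measurable_snd))
    (ne_top_of_le_ne_top hsum hle) (Eventually.of_forall key)
  rw [lintegral_add_left hm1, e1, lintegral_add_left hm12, e2] at hlt
  exact absurd (add_le_add h2 h2) (not_le.2 hlt)

/-- A closed monotone set is single-valued almost everywhere. -/
lemma aux_single {m : ℕ} (S : Set (Vec m × Vec m)) (hS : IsClosed S)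
    (hmon : ∀ a ∈ S, ∀ b ∈ S, 0 ≤ (inner ℝ (a.1 - b.1) (a.2 - b.2) : ℝ)) :
    ∀ᵐ x ∂(volume : Measure (Vec m)), ∀ y y', (x, y) ∈ S → (x, y') ∈ S → y = y' := by
  -- compact pieces
  let C : Fin m → ℚ → ℚ → ℕ → Set (Vec m × Vec m × Vec m) := fun i r s K =>
    {t | (t.1, t.2.1) ∈ S ∧ (t.1, t.2.2) ∈ S ∧ t.2.1 i ≤ r ∧ (s : ℝ) ≤ t.2.2 i} ∩
      Metric.closedBall 0 K
  have hC : ∀ i r s K, IsCompact (C i r s K) := by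
    intro i r s K
    refine (isCompact_closedBall _ _).inter_left ?_
    refine IsClosed.inter (hS.preimage (by fun_prop)) (IsClosed.inter (hS.preimage (by fun_prop))
      (IsClosed.inter (isClosed_le (f := fun t : Vec m × Vec m × Vec m => t.2.1 i)
          (g := fun _ => (r : ℝ)) (by fun_prop) (by fun_prop))
        (isClosed_le (f := fun _ : Vec m × Vec m × Vec m => (s : ℝ))
          (g := fun t => t.2.2 i) (by fun_prop) (by fun_prop))))
  have hnull : ∀ i (r s : ℚ) K, r < s → volume (Prod.fst '' C i r s K) = 0 := by
    intro i r s K hrs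
    have hrs' : (r : ℝ) < s := by exact_mod_cast hrs
    refine Measure.addHaar_eq_zero_of_disjoint_translates volume
      (fun n : ℕ => (1 / ((n : ℝ) + 1)) • EuclideanSpace.single i (1 : ℝ)) ?_ ?_
      ((hC i r s K).image continuous_fst).measurableSet
    · refine isBounded_iff_forall_norm_le.2 ⟨1, ?_⟩
      rintro _ ⟨n, rfl⟩
      simp only [norm_smul, PiLp.norm_single, norm_one, mul_one]
      rw [Real.norm_of_nonneg (by positivity), div_le_one (by positivity)]
      linarith [(Nat.cast_nonneg n : (0 : ℝ) ≤ n)]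
    · -- no two points of the piece differ by a positive multiple of `e_i`
      have hno : ∀ a ∈ Prod.fst '' C i r s K, ∀ b ∈ Prod.fst '' C i r s K, ∀ t : ℝ, 0 < t →
          b = a + t • EuclideanSpace.single i (1 : ℝ) → False := by
        rintro _ ⟨⟨x, y, y'⟩, ⟨⟨-, h2, -, h4⟩, -⟩, rfl⟩ _ ⟨⟨u, v, v'⟩, ⟨⟨g1, -, g3, -⟩, -⟩, rfl⟩ t ht hab
        have := hmon _ g1 _ h2
        dsimp only at hab h4 g3 this
        rw [hab, add_sub_cancel_left, real_inner_smul_left,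
          EuclideanSpace.inner_single_left] at this
        simp at this
        have := (mul_nonneg_iff_of_pos_left ht).1 this
        linarith
      have hinj : ∀ k n : ℕ, k < n → (1 / ((n : ℝ) + 1)) < (1 / ((k : ℝ) + 1)) := fun k n h =>
        one_div_lt_one_div_of_lt (by positivity) (by exact_mod_cast Nat.succ_lt_succ h)
      have hdis : ∀ k n : ℕ, k < n → ∀ a ∈ Prod.fst '' C i r s K, ∀ b ∈ Prod.fst '' C i r s K,
          (1 / ((k : ℝ) + 1)) • EuclideanSpace.single i (1 : ℝ) + a
            = (1 / ((n : ℝ) + 1)) • EuclideanSpace.single i (1 : ℝ) + b → False := by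
        intro k n h a ha b hb hab
        refine hno a ha b hb (1 / ((k : ℝ) + 1) - 1 / ((n : ℝ) + 1)) (sub_pos.2 (hinj k n h)) ?_
        rw [sub_smul]
        rw [← sub_eq_iff_eq_add'] at hab
        rw [← hab]; abel
      intro k n hkn
      refine Set.disjoint_left.2 ?_
      simp only [Set.singleton_add]
      rintro _ ⟨a, ha, rfl⟩ ⟨b, hb, hab⟩
      rcases lt_or_gt_of_ne hkn with h | h
      · exact hdis k n h a ha b hb hab.symm
      · exact hdis n k h b hb a ha hab
  have hall : ∀ᵐ x ∂(volume : Measure (Vec m)), ∀ i (r s : ℚ) (K : ℕ), r < s →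
      x ∉ Prod.fst '' C i r s K := by
    refine ae_all_iff.2 fun i => ae_all_iff.2 fun r => ae_all_iff.2 fun s =>
      ae_all_iff.2 fun K => ?_
    by_cases h : r < s
    · have := measure_eq_zero_iff_ae_notMem.1 (hnull i r s K h)
      filter_upwards [this] with x hx _ using hx
    · exact Eventually.of_forall fun x hx => absurd hx h
  filter_upwards [hall] with x hx
  have hlt : ∀ i y y', (x, y) ∈ S → (x, y') ∈ S → ¬ y i < y' i := by
    intro i y y' hy hy' hi
    obtain ⟨r, hr1, hr2⟩ := exists_rat_btwn hi
    obtain ⟨s, hs1, hs2⟩ := exists_rat_btwn hr2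
    obtain ⟨K, hK⟩ := exists_nat_ge ‖(x, y, y')‖
    refine hx i r s K (by exact_mod_cast hs1) ⟨(x, y, y'), ⟨⟨hy, hy', hr1.le, hs2.le⟩, ?_⟩, rfl⟩
    simpa using hK
  intro y y' hy hy'
  ext i
  exact le_antisymm (not_lt.1 (hlt i y' y hy' hy)) (not_lt.1 (hlt i y y' hy hy'))

/-- Uniqueness of the optimal coupling. -/
lemma aux_unique {d m : ℕ} (μ : Measure (Vec d)) [IsProbabilityMeasure μ] (G : Measure (Vec m))
    (θbar : Vec d → Vec m) (hθ : Measurable θbar)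
    (hA2 : (μ.map θbar) ≪ (volume : Measure (Vec m)))
    (δstar : Vec d → Vec m) (hδmeas : Measurable δstar) (hδpush : μ.map δstar = G)
    (hδmin : ∀ π : Measure (Vec d × Vec m), IsCoupling π μ G →
      ∫⁻ p, ENNReal.ofReal (‖θbar p.1 - p.2‖ ^ 2) ∂(μ.map fun z => (z, δstar z)) ≤
        ∫⁻ p, ENNReal.ofReal (‖θbar p.1 - p.2‖ ^ 2) ∂π)
    (π : Measure (Vec d × Vec m)) (hπ : IsCoupling π μ G)
    (hfin : ∫⁻ p, ENNReal.ofReal (‖θbar p.1 - p.2‖ ^ 2) ∂π ≠ ⊤)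
    (hle : ∫⁻ p, ENNReal.ofReal (‖θbar p.1 - p.2‖ ^ 2) ∂π ≤
      ∫⁻ p, ENNReal.ofReal (‖θbar p.1 - p.2‖ ^ 2) ∂(μ.map fun z => (z, δstar z))) :
    ∀ᵐ p ∂π, p.2 = δstar p.1 := by
  have hgm : Measurable fun z => (z, δstar z) := measurable_id.prodMk hδmeas
  set π0 := μ.map fun z => (z, δstar z) with hπ0
  have hp0 : IsProbabilityMeasure π0 := Measure.isProbabilityMeasure_map hgm.aemeasurable
  have hp : IsProbabilityMeasure π := by
    have : IsProbabilityMeasure (π.map Prod.fst) := by rw [hπ.1]; infer_instance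
    exact ⟨by rw [← this.measure_univ, Measure.map_apply measurable_fst .univ]; rfl⟩
  have hc0 : IsCoupling π0 μ G := by
    constructor
    · rw [hπ0, Measure.map_map measurable_fst hgm]; exact Measure.map_id
    · rw [hπ0, Measure.map_map measurable_snd hgm]; exact hδpush
  have heq := le_antisymm hle (hδmin π hπ)
  set ρ : Measure (Vec d × Vec m) := (2⁻¹ : ℝ≥0∞) • π0 + (2⁻¹ : ℝ≥0∞) • π with hρ
  have hhalf : ∀ x : ℝ≥0∞, 2⁻¹ * x + 2⁻¹ * x = x := fun x => by
    rw [← add_mul, ENNReal.inv_two_add_inv_two, one_mul]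
  have hhalfm : ∀ {X : Type} [MeasurableSpace X] (x : Measure X),
      (2⁻¹ : ℝ≥0∞) • x + (2⁻¹ : ℝ≥0∞) • x = x := fun x => by
    rw [← add_smul, ENNReal.inv_two_add_inv_two, one_smul]
  have hρp : IsProbabilityMeasure ρ := ⟨by
    simp [hρ, ENNReal.inv_two_add_inv_two]⟩
  have hρc : IsCoupling ρ μ G := by
    constructor
    · rw [hρ, Measure.map_add _ _ measurable_fst, Measure.map_smul, Measure.map_smul, hc0.1, hπ.1,
        hhalfm]
    · rw [hρ, Measure.map_add _ _ measurable_snd, Measure.map_smul, Measure.map_smul, hc0.2, hπ.2,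
        hhalfm]
  have hρcost : ∫⁻ p, ENNReal.ofReal (‖θbar p.1 - p.2‖ ^ 2) ∂ρ =
      ∫⁻ p, ENNReal.ofReal (‖θbar p.1 - p.2‖ ^ 2) ∂π := by
    rw [hρ, lintegral_add_measure, lintegral_smul_measure, lintegral_smul_measure, ← heq]
    exact hhalf _
  have hmon := aux_swap μ G θbar hθ ρ hρc (by rwa [hρcost])
    (fun π' h => by rw [hρcost, heq]; exact hδmin π' h)
  have hΦ : Measurable fun p : Vec d × Vec m => (θbar p.1, p.2) :=
    (hθ.comp measurable_fst).prodMk measurable_snd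
  set γ := ρ.map fun p => (θbar p.1, p.2) with hγ
  have hγp : IsProbabilityMeasure γ := Measure.isProbabilityMeasure_map hΦ.aemeasurable
  have hmonS : ∀ a ∈ γ.support, ∀ b ∈ γ.support,
      0 ≤ (inner ℝ (a.1 - b.1) (a.2 - b.2) : ℝ) := by
    intro a ha b hb
    by_contra hneg
    have hopen : IsOpen {q : (Vec m × Vec m) × (Vec m × Vec m) |
        (inner ℝ (q.1.1 - q.2.1) (q.1.2 - q.2.2) : ℝ) < 0} :=
      isOpen_lt (by fun_prop) continuous_const
    have hmem := hopen.mem_nhds (x := (a, b)) (not_le.1 hneg)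
    rw [mem_nhds_prod_iff] at hmem
    obtain ⟨U, hU, V, hV, hUV⟩ := hmem
    have hUp := (Measure.mem_support_iff_forall a).1 ha U hU
    have hVp := (Measure.mem_support_iff_forall b).1 hb V hV
    have hz : (γ.prod γ) (U ×ˢ V) = 0 := by
      refine measure_mono_null hUV ?_
      rw [hγ, Measure.map_prod_map _ _ hΦ hΦ, Measure.map_apply (hΦ.prodMap hΦ) hopen.measurableSet]
      rw [ae_iff] at hmon
      refine measure_mono_null ?_ hmon
      intro q hq
      exact not_le.2 hq
    rw [Measure.prod_prod] at hz
    rcases mul_eq_zero.1 hz with h | h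
    · exact hUp.ne' h
    · exact hVp.ne' h
  have hsing := aux_single γ.support Measure.isClosed_support hmonS
  have hsing' : ∀ᵐ z ∂μ, ∀ y y', (θbar z, y) ∈ γ.support → (θbar z, y') ∈ γ.support → y = y' :=
    ae_of_ae_map hθ.aemeasurable (hA2.ae_le hsing)
  have hρS : ∀ᵐ p ∂ρ, (θbar p.1, p.2) ∈ γ.support :=
    ae_of_ae_map hΦ.aemeasurable (Measure.support_mem_ae (μ := γ))
  have hπρ : π ≪ ρ := by
    refine Measure.AbsolutelyContinuous.mk fun s _ hs => ?_
    simpa [hρ] using (by simpa [hρ] using hs : _ ∧ _).2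
  have hπ0ρ : π0 ≪ ρ := by
    refine Measure.AbsolutelyContinuous.mk fun s _ hs => ?_
    simpa [hρ] using (by simpa [hρ] using hs : _ ∧ _).1
  have hzS : ∀ᵐ z ∂μ, (θbar z, δstar z) ∈ γ.support :=
    ae_of_ae_map hgm.aemeasurable (hπ0ρ.ae_le hρS)
  have hboth : ∀ᵐ p ∂π, (θbar p.1, δstar p.1) ∈ γ.support ∧
      ∀ y y', (θbar p.1, y) ∈ γ.support → (θbar p.1, y') ∈ γ.support → y = y' := by
    have := hzS.and hsing'
    rw [← hπ.1] at this
    exact ae_of_ae_map measurable_fst.aemeasurable this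
  filter_upwards [hboth, hπρ.ae_le hρS] with p h1 h2
  exact h1.2 _ _ h2 h1.1

lemma aux_identity {m : ℕ} (τ : ℝ) (hτ : 0 < τ) (a x b : Vec m) :
    ‖a - x‖ ^ 2 + 1 / (2 * τ) * ‖x - b‖ ^ 2 =
      1 / (1 + 2 * τ) * ‖a - b‖ ^ 2 + (1 + 2 * τ) / (2 * τ) *
        ‖x - ((2 * τ / (1 + 2 * τ)) • a + (1 / (1 + 2 * τ)) • b)‖ ^ 2 := by
  have h1 : (1 + 2 * τ) ≠ 0 := by positivity
  have h2 : τ ≠ 0 := hτ.ne'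
  simp only [@norm_sub_sq_real, @norm_add_sq_real, inner_add_right, real_inner_smul_left,
    real_inner_smul_right, norm_smul, mul_pow, Real.norm_eq_abs, sq_abs]
  rw [real_inner_comm x a]
  field_simp
  ring

lemma aux_identity' {m : ℕ} (τ : ℝ) (hτ : 0 < τ) (a x b : Vec m) :
    ENNReal.ofReal (‖a - x‖ ^ 2) + ENNReal.ofReal (1 / (2 * τ)) * ENNReal.ofReal (‖x - b‖ ^ 2) =
      ENNReal.ofReal (1 / (1 + 2 * τ)) * ENNReal.ofReal (‖a - b‖ ^ 2) +
        ENNReal.ofReal ((1 + 2 * τ) / (2 * τ)) * ENNReal.ofReal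
        (‖x - ((2 * τ / (1 + 2 * τ)) • a + (1 / (1 + 2 * τ)) • b)‖ ^ 2) := by
  rw [← ENNReal.ofReal_mul (by positivity), ← ENNReal.ofReal_mul (by positivity),
    ← ENNReal.ofReal_mul (by positivity), ← ENNReal.ofReal_add (by positivity) (by positivity),
    ← ENNReal.ofReal_add (by positivity) (by positivity), aux_identity τ hτ]

/-- Gluing. -/
lemma aux_glue {d m : ℕ} (π : Measure (Vec d × Vec m)) (ρ : Measure (Vec m × Vec m))
    [IsProbabilityMeasure π] [IsProbabilityMeasure ρ] (h : π.map Prod.snd = ρ.map Prod.fst) :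
    ∃ Λ : Measure ((Vec d × Vec m) × Vec m), Λ.map Prod.fst = π ∧
      Λ.map (fun w => (w.1.2, w.2)) = ρ := by
  have hmm : Measurable fun w : (Vec d × Vec m) × Vec m => (w.1.2, w.2) := by fun_prop
  refine ⟨π ⊗ₘ (ρ.condKernel.comap Prod.snd measurable_snd), Measure.fst_compProd _ _, ?_⟩
  refine Measure.ext_of_lintegral _ fun f hf => ?_
  rw [lintegral_map hf hmm, Measure.lintegral_compProd (f := fun w : (Vec d × Vec m) × Vec m => f (w.1.2, w.2)) (hf.comp hmm)]
  simp only [Kernel.comap_apply]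
  conv_rhs => rw [← ρ.disintegrate ρ.condKernel]
  rw [Measure.lintegral_compProd hf, Measure.fst, ← h,
    lintegral_map hf.lintegral_kernel_prod_right' measurable_snd]

/-- Finiteness of the optimal cost. -/
lemma aux_fin {d m : ℕ} (P : Measure (Vec d × Vec m)) [IsProbabilityMeasure P]
    (θbar : Vec d → Vec m) (hθbar : IsPosteriorMean P θbar)
    (hA1 : ∫⁻ θ, ENNReal.ofReal (‖θ‖ ^ 2) ∂(P.map Prod.snd) < ⊤) :
    ∫⁻ p, ENNReal.ofReal (‖θbar p.1 - p.2‖ ^ 2) ∂P ≠ ⊤ := by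
  have hm2 : MemLp (fun p : Vec d × Vec m => p.2) 2 P := by
    rw [memLp_two_iff_integrable_sq_norm measurable_snd.aestronglyMeasurable]
    refine ⟨by fun_prop, ?_⟩
    rw [hasFiniteIntegral_iff_ofReal (Eventually.of_forall fun _ => by positivity)]
    rwa [lintegral_map (by fun_prop) measurable_snd] at hA1
  have hm1 : MemLp (fun p : Vec d × Vec m => θbar p.1) 2 P :=
    (memLp_congr_ae hθbar.2).2 (hm2.condExp (by norm_num))
  have hs := hm1.sub hm2
  rw [memLp_two_iff_integrable_sq_norm hs.1] at hs
  have := hs.2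
  rw [hasFiniteIntegral_iff_ofReal (Eventually.of_forall fun _ => by positivity)] at this
  exact this.ne

/-- Lower bound for the relaxed problem, with the equality case. -/
lemma aux_main {d m : ℕ} (μ : Measure (Vec d)) [IsProbabilityMeasure μ] (G : Measure (Vec m))
    (θbar : Vec d → Vec m) (hθ : Measurable θbar)
    (hA2 : (μ.map θbar) ≪ (volume : Measure (Vec m)))
    (δstar : Vec d → Vec m) (hδmeas : Measurable δstar) (hδpush : μ.map δstar = G)
    (hδmin : ∀ π : Measure (Vec d × Vec m), IsCoupling π μ G →
      ∫⁻ p, ENNReal.ofReal (‖θbar p.1 - p.2‖ ^ 2) ∂(μ.map fun z => (z, δstar z)) ≤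
        ∫⁻ p, ENNReal.ofReal (‖θbar p.1 - p.2‖ ^ 2) ∂π)
    (hfin : ∫⁻ p, ENNReal.ofReal (‖θbar p.1 - p.2‖ ^ 2) ∂(μ.map fun z => (z, δstar z)) ≠ ⊤)
    (τ : ℝ) (hτ : 0 < τ)
    (π : Measure (Vec d × Vec m)) (ρ : Measure (Vec m × Vec m))
    [IsProbabilityMeasure π] [IsProbabilityMeasure ρ]
    (h1 : π.map Prod.fst = μ) (h2 : ρ.map Prod.snd = G) (h : π.map Prod.snd = ρ.map Prod.fst) :
    ENNReal.ofReal (1 / (1 + 2 * τ)) *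
        ∫⁻ p, ENNReal.ofReal (‖θbar p.1 - p.2‖ ^ 2) ∂(μ.map fun z => (z, δstar z)) ≤
      (∫⁻ p, ENNReal.ofReal (‖θbar p.1 - p.2‖ ^ 2) ∂π) +
        ENNReal.ofReal (1 / (2 * τ)) * ∫⁻ q, ENNReal.ofReal (‖q.1 - q.2‖ ^ 2) ∂ρ ∧
    ((∫⁻ p, ENNReal.ofReal (‖θbar p.1 - p.2‖ ^ 2) ∂π) +
        ENNReal.ofReal (1 / (2 * τ)) * ∫⁻ q, ENNReal.ofReal (‖q.1 - q.2‖ ^ 2) ∂ρ =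
      ENNReal.ofReal (1 / (1 + 2 * τ)) *
        ∫⁻ p, ENNReal.ofReal (‖θbar p.1 - p.2‖ ^ 2) ∂(μ.map fun z => (z, δstar z)) →
      π = (μ.map fun z =>
          (z, (2 * τ / (1 + 2 * τ)) • θbar z + (1 / (1 + 2 * τ)) • δstar z)) ∧
      ρ = (μ.map fun z =>
          ((2 * τ / (1 + 2 * τ)) • θbar z + (1 / (1 + 2 * τ)) • δstar z, δstar z))) := by
  obtain ⟨Λ, hΛ1, hΛ2⟩ := aux_glue π ρ h
  have hm12 : Measurable fun w : (Vec d × Vec m) × Vec m => (w.1.2, w.2) := by fun_prop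
  have hm13 : Measurable fun w : (Vec d × Vec m) × Vec m => (w.1.1, w.2) := by fun_prop
  have hw1 : Measurable fun w : (Vec d × Vec m) × Vec m => w.1.1 := by fun_prop
  have hcm : Measurable fun p : Vec d × Vec m => ENNReal.ofReal (‖θbar p.1 - p.2‖ ^ 2) := by
    fun_prop
  have hcm2 : Measurable fun p : Vec m × Vec m => ENNReal.ofReal (‖p.1 - p.2‖ ^ 2) := by
    fun_prop
  have hΛz : Λ.map (fun w => w.1.1) = μ := by
    rw [← h1, ← hΛ1, Measure.map_map measurable_fst measurable_fst]; rfl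
  have hc13 : IsCoupling (Λ.map fun w => (w.1.1, w.2)) μ G := by
    constructor
    · rw [Measure.map_map measurable_fst hm13]; exact hΛz
    · rw [Measure.map_map measurable_snd hm13, ← h2, ← hΛ2, Measure.map_map measurable_snd hm12]
      rfl
  set R : (Vec d × Vec m) × Vec m → ℝ≥0∞ := fun w => ENNReal.ofReal
    (‖w.1.2 - ((2 * τ / (1 + 2 * τ)) • θbar w.1.1 + (1 / (1 + 2 * τ)) • w.2)‖ ^ 2) with hR
  have hRm : Measurable R := by fun_prop
  set K := ∫⁻ p, ENNReal.ofReal (‖θbar p.1 - p.2‖ ^ 2) ∂(μ.map fun z => (z, δstar z)) with hK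
  set C := ∫⁻ p, ENNReal.ofReal (‖θbar p.1 - p.2‖ ^ 2) ∂(Λ.map fun w => (w.1.1, w.2)) with hC
  have hobj : (∫⁻ p, ENNReal.ofReal (‖θbar p.1 - p.2‖ ^ 2) ∂π) +
        ENNReal.ofReal (1 / (2 * τ)) * ∫⁻ q, ENNReal.ofReal (‖q.1 - q.2‖ ^ 2) ∂ρ =
      ENNReal.ofReal (1 / (1 + 2 * τ)) * C +
        ENNReal.ofReal ((1 + 2 * τ) / (2 * τ)) * ∫⁻ w, R w ∂Λ := by
    rw [hC, lintegral_map hcm hm13, ← hΛ1, ← hΛ2, lintegral_map hcm measurable_fst,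
      lintegral_map hcm2 hm12, ← lintegral_const_mul _ (by fun_prop),
      ← lintegral_const_mul _ (by fun_prop), ← lintegral_const_mul _ hRm,
      ← lintegral_add_left (by fun_prop), ← lintegral_add_left (by fun_prop)]
    exact lintegral_congr fun w => aux_identity' τ hτ _ _ _
  have hKC : K ≤ C := hδmin _ hc13
  have ha : ENNReal.ofReal (1 / (1 + 2 * τ)) ≠ 0 := by
    rw [ne_eq, ENNReal.ofReal_eq_zero, not_le]; positivity
  have hb : ENNReal.ofReal ((1 + 2 * τ) / (2 * τ)) ≠ 0 := by
    rw [ne_eq, ENNReal.ofReal_eq_zero, not_le]; positivity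
  rw [hobj]
  refine ⟨(mul_le_mul_right hKC _).trans le_self_add, fun heq => ?_⟩
  have haK : ENNReal.ofReal (1 / (1 + 2 * τ)) * K ≠ ⊤ := ENNReal.mul_ne_top ENNReal.ofReal_ne_top hfin
  have haCK : ENNReal.ofReal (1 / (1 + 2 * τ)) * C ≤ ENNReal.ofReal (1 / (1 + 2 * τ)) * K :=
    heq ▸ le_self_add
  have hCK : C ≤ K := (ENNReal.mul_le_mul_iff_right ha ENNReal.ofReal_ne_top).1 haCK
  have hCeq : C = K := le_antisymm hCK hKC
  have hR0 : ∫⁻ w, R w ∂Λ = 0 := by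
    rw [hCeq] at heq
    have h0 : ENNReal.ofReal ((1 + 2 * τ) / (2 * τ)) * ∫⁻ w, R w ∂Λ = 0 := by
      have : ENNReal.ofReal (1 / (1 + 2 * τ)) * K +
          ENNReal.ofReal ((1 + 2 * τ) / (2 * τ)) * ∫⁻ w, R w ∂Λ =
          ENNReal.ofReal (1 / (1 + 2 * τ)) * K + 0 := by rw [heq, add_zero]
      exact (ENNReal.add_right_inj haK).1 this
    exact (mul_eq_zero.1 h0).resolve_left hb
  have hopt := aux_unique μ G θbar hθ hA2 δstar hδmeas hδpush hδmin _ hc13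
    (by rw [← hC, hCeq]; exact hfin) hCK
  have hθ2 : ∀ᵐ w ∂Λ, w.2 = δstar w.1.1 := ae_of_ae_map hm13.aemeasurable hopt
  have hx : ∀ᵐ w ∂Λ, w.1.2 = (2 * τ / (1 + 2 * τ)) • θbar w.1.1 + (1 / (1 + 2 * τ)) • w.2 := by
    rw [lintegral_eq_zero_iff hRm] at hR0
    filter_upwards [hR0] with w hw
    have : ‖w.1.2 - ((2 * τ / (1 + 2 * τ)) • θbar w.1.1 + (1 / (1 + 2 * τ)) • w.2)‖ ^ 2 = 0 :=
      le_antisymm (ENNReal.ofReal_eq_zero.1 hw) (by positivity)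
    exact sub_eq_zero.1 (norm_eq_zero.1 (pow_eq_zero_iff (two_ne_zero)|>.1 this))
  constructor
  · rw [← hΛz, Measure.map_map (by fun_prop) hw1, ← hΛ1]
    refine Measure.map_congr ?_
    filter_upwards [hθ2, hx] with w hw1 hw2
    simp only [Function.comp]
    rw [← hw1, ← hw2]
  · rw [← hΛz, Measure.map_map (by fun_prop) hw1]
    nth_rewrite 1 [← hΛ2]
    refine Measure.map_congr ?_
    filter_upwards [hθ2, hx] with w hw1 hw2
    simp only [Function.comp]
    rw [← hw1, ← hw2]

/-- Under Assumptions 1 and 2, the pair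
`(π*, π̃*) = ((Id × δ*_τ)♯μ, (δ*_τ × δ*)♯μ)` with
`δ*_τ = (2τ/(1+2τ)) θ̄ + (1/(1+2τ)) δ*` is the unique solution of the relaxed
two-coupling problem. -/
theorem stmt14 {d m : ℕ}
    (P : Measure (Vec d × Vec m)) [IsProbabilityMeasure P]
    (μ : Measure (Vec d)) (G : Measure (Vec m))
    (hμ : μ = P.map Prod.fst) (hG : G = P.map Prod.snd)
    (θbar : Vec d → Vec m) (hθbar : IsPosteriorMean P θbar)
    -- Assumptions 1 and 2
    (hA1 : ∫⁻ θ, ENNReal.ofReal (‖θ‖ ^ 2) ∂G < ⊤)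
    (hA2 : (μ.map θbar) ≪ (volume : Measure (Vec m)))
    -- `δ*` is the OT-based denoiser
    (δstar : Vec d → Vec m) (hδmeas : Measurable δstar) (hδpush : μ.map δstar = G)
    (hδmin : ∀ π : Measure (Vec d × Vec m), IsCoupling π μ G →
      ∫⁻ p, ENNReal.ofReal (‖θbar p.1 - p.2‖ ^ 2) ∂(μ.map fun z => (z, δstar z)) ≤
        ∫⁻ p, ENNReal.ofReal (‖θbar p.1 - p.2‖ ^ 2) ∂π)
    (τ : ℝ) (hτ : 0 < τ) :
    -- the pair `(π*, π̃*)` is feasible …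
    ((μ.map fun z => (z, (2 * τ / (1 + 2 * τ)) • θbar z + (1 / (1 + 2 * τ)) • δstar z)),
     (μ.map fun z =>
        ((2 * τ / (1 + 2 * τ)) • θbar z + (1 / (1 + 2 * τ)) • δstar z, δstar z))) ∈
      {pp : Measure (Vec d × Vec m) × Measure (Vec m × Vec m) |
        IsProbabilityMeasure pp.1 ∧ IsProbabilityMeasure pp.2 ∧
        pp.1.map Prod.fst = μ ∧ pp.2.map Prod.snd = G ∧
        pp.1.map Prod.snd = pp.2.map Prod.fst} ∧
    -- … minimizes the relaxed two-coupling objective …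
    (∀ pp ∈ {pp : Measure (Vec d × Vec m) × Measure (Vec m × Vec m) |
        IsProbabilityMeasure pp.1 ∧ IsProbabilityMeasure pp.2 ∧
        pp.1.map Prod.fst = μ ∧ pp.2.map Prod.snd = G ∧
        pp.1.map Prod.snd = pp.2.map Prod.fst},
      (∫⁻ p, ENNReal.ofReal (‖θbar p.1 - p.2‖ ^ 2)
          ∂(μ.map fun z =>
            (z, (2 * τ / (1 + 2 * τ)) • θbar z + (1 / (1 + 2 * τ)) • δstar z))) +
        ENNReal.ofReal (1 / (2 * τ)) *
          ∫⁻ q, ENNReal.ofReal (‖q.1 - q.2‖ ^ 2)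
            ∂(μ.map fun z =>
              ((2 * τ / (1 + 2 * τ)) • θbar z + (1 / (1 + 2 * τ)) • δstar z, δstar z)) ≤
      (∫⁻ p, ENNReal.ofReal (‖θbar p.1 - p.2‖ ^ 2) ∂pp.1) +
        ENNReal.ofReal (1 / (2 * τ)) * ∫⁻ q, ENNReal.ofReal (‖q.1 - q.2‖ ^ 2) ∂pp.2) ∧
    -- … and is the unique minimizer
    (∀ pp ∈ {pp : Measure (Vec d × Vec m) × Measure (Vec m × Vec m) |
        IsProbabilityMeasure pp.1 ∧ IsProbabilityMeasure pp.2 ∧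
        pp.1.map Prod.fst = μ ∧ pp.2.map Prod.snd = G ∧
        pp.1.map Prod.snd = pp.2.map Prod.fst},
      ((∫⁻ p, ENNReal.ofReal (‖θbar p.1 - p.2‖ ^ 2) ∂pp.1) +
          ENNReal.ofReal (1 / (2 * τ)) * ∫⁻ q, ENNReal.ofReal (‖q.1 - q.2‖ ^ 2) ∂pp.2 =
        (∫⁻ p, ENNReal.ofReal (‖θbar p.1 - p.2‖ ^ 2)
            ∂(μ.map fun z =>
              (z, (2 * τ / (1 + 2 * τ)) • θbar z + (1 / (1 + 2 * τ)) • δstar z))) +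
          ENNReal.ofReal (1 / (2 * τ)) *
            ∫⁻ q, ENNReal.ofReal (‖q.1 - q.2‖ ^ 2)
              ∂(μ.map fun z =>
                ((2 * τ / (1 + 2 * τ)) • θbar z + (1 / (1 + 2 * τ)) • δstar z, δstar z))) →
      pp.1 = (μ.map fun z =>
          (z, (2 * τ / (1 + 2 * τ)) • θbar z + (1 / (1 + 2 * τ)) • δstar z)) ∧
      pp.2 = (μ.map fun z =>
          ((2 * τ / (1 + 2 * τ)) • θbar z + (1 / (1 + 2 * τ)) • δstar z, δstar z))) := by
  have hθ := hθbar.1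
  have hμp : IsProbabilityMeasure μ := by
    rw [hμ]; exact Measure.isProbabilityMeasure_map measurable_fst.aemeasurable
  have hgm : Measurable fun z => (z, δstar z) := measurable_id.prodMk hδmeas
  have hfin : ∫⁻ p, ENNReal.ofReal (‖θbar p.1 - p.2‖ ^ 2) ∂(μ.map fun z => (z, δstar z)) ≠ ⊤ :=
    ne_top_of_le_ne_top (aux_fin P θbar hθbar (hG ▸ hA1)) (hδmin P ⟨hμ.symm, hG.symm⟩)
  have hma : Measurable fun z =>
      (z, (2 * τ / (1 + 2 * τ)) • θbar z + (1 / (1 + 2 * τ)) • δstar z) := by fun_prop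
  have hmb : Measurable fun z =>
      ((2 * τ / (1 + 2 * τ)) • θbar z + (1 / (1 + 2 * τ)) • δstar z, δstar z) := by fun_prop
  have hval : (∫⁻ p, ENNReal.ofReal (‖θbar p.1 - p.2‖ ^ 2)
          ∂(μ.map fun z =>
            (z, (2 * τ / (1 + 2 * τ)) • θbar z + (1 / (1 + 2 * τ)) • δstar z))) +
        ENNReal.ofReal (1 / (2 * τ)) *
          ∫⁻ q, ENNReal.ofReal (‖q.1 - q.2‖ ^ 2)
            ∂(μ.map fun z =>
              ((2 * τ / (1 + 2 * τ)) • θbar z + (1 / (1 + 2 * τ)) • δstar z, δstar z)) =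
      ENNReal.ofReal (1 / (1 + 2 * τ)) *
        ∫⁻ p, ENNReal.ofReal (‖θbar p.1 - p.2‖ ^ 2) ∂(μ.map fun z => (z, δstar z)) := by
    rw [lintegral_map (by fun_prop) hma, lintegral_map (by fun_prop) hmb,
      lintegral_map (by fun_prop) hgm, ← lintegral_const_mul _ (by fun_prop),
      ← lintegral_const_mul _ (by fun_prop), ← lintegral_add_left (by fun_prop)]
    refine lintegral_congr fun z => ?_
    rw [aux_identity' τ hτ]
    simp
  refine ⟨⟨Measure.isProbabilityMeasure_map hma.aemeasurable,
    Measure.isProbabilityMeasure_map hmb.aemeasurable, ?_, ?_, ?_⟩, ?_, ?_⟩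
  · rw [Measure.map_map measurable_fst hma]; exact Measure.map_id
  · rw [Measure.map_map measurable_snd hmb]; exact hδpush
  · rw [Measure.map_map measurable_snd hma, Measure.map_map measurable_fst hmb]; rfl
  · rintro ⟨π, ρ⟩ ⟨p1, p2, h1, h2, h3⟩
    dsimp only at p1 p2 h1 h2 h3
    rw [hval]
    exact (aux_main μ G θbar hθ hA2 δstar hδmeas hδpush hδmin hfin τ hτ π ρ h1 h2 h3).1
  · rintro ⟨π, ρ⟩ ⟨p1, p2, h1, h2, h3⟩
    dsimp only at p1 p2 h1 h2 h3
    rw [hval]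
    exact (aux_main μ G θbar hθ hA2 δstar hδmeas hδpush hδmin hfin τ hτ π ρ h1 h2 h3).2

end
end

section
/- Let μ be a Borel probability measure on ℝ^d and let Tₙ, T : ℝ^d → ℝ^m be Borel measurable maps. Then the measures πₙ := (Id × Tₙ)♯μ converge weakly to π := (Id × T)♯μ if and only if Tₙ converges to T in μ-measure, i.e. for every η > 0, lim_{n→∞} μ({z ∈ ℝ^d : |Tₙ(z) − T(z)| ≥ η}) = 0. -/
open MeasureTheory Filter

noncomputable section

lemma aux_integrable {X F : Type*} [MeasurableSpace X] [NormedAddCommGroup F] [MeasurableSpace F]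
    [BorelSpace F] [SecondCountableTopology F]
    (μ : Measure X) [IsProbabilityMeasure μ] {A B : X → F} (hA : Measurable A) (hB : Measurable B) :
    Integrable (fun z => min (1:ℝ) ‖A z - B z‖) μ := by
  refine Integrable.of_bound (C := 1) ?_ ?_
  · exact (measurable_const.min (hA.sub hB).norm).aestronglyMeasurable
  · refine Eventually.of_forall fun z => ?_
    have h0 : (0:ℝ) ≤ min (1:ℝ) ‖A z - B z‖ := le_min zero_le_one (norm_nonneg _)
    rw [Real.norm_of_nonneg h0]
    exact min_le_left _ _

lemma aux_tri {F : Type*} [NormedAddCommGroup F] (a b c : F) :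
    min (1:ℝ) ‖a - c‖ ≤ min (1:ℝ) ‖a - b‖ + min (1:ℝ) ‖b - c‖ := by
  have h := norm_sub_le_norm_sub_add_norm_sub a b c
  have h1 := norm_nonneg (a - b)
  have h2 := norm_nonneg (b - c)
  rcases le_total (1:ℝ) ‖a - b‖ with h3 | h3 <;> rcases le_total (1:ℝ) ‖b - c‖ with h4 | h4 <;>
    simp only [min_eq_left, min_eq_right, h3, h4]
  · linarith [min_le_left (1:ℝ) ‖a - c‖]
  · linarith [min_le_left (1:ℝ) ‖a - c‖]
  · linarith [min_le_left (1:ℝ) ‖a - c‖]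
  · linarith [min_le_right (1:ℝ) ‖a - c‖]

lemma aux_approx {d m : ℕ}
    (μ : Measure (EuclideanSpace ℝ (Fin d))) [IsProbabilityMeasure μ]
    (T : EuclideanSpace ℝ (Fin d) → EuclideanSpace ℝ (Fin m)) (hT : Measurable T)
    (ε : ℝ) (hε : 0 < ε) :
    ∃ S : EuclideanSpace ℝ (Fin d) → EuclideanSpace ℝ (Fin m), Continuous S ∧
      ∫ z, min (1:ℝ) ‖T z - S z‖ ∂μ < ε := by
  classical
  let Tk : ℕ → EuclideanSpace ℝ (Fin d) → EuclideanSpace ℝ (Fin m) :=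
    fun k => {z | ‖T z‖ ≤ k}.indicator T
  have hTk : ∀ k, Measurable (Tk k) := fun k =>
    hT.indicator (measurableSet_le hT.norm measurable_const)
  have hlim : Tendsto (fun k => ∫ z, min (1:ℝ) ‖T z - Tk k z‖ ∂μ) atTop
      (nhds (∫ _z, (0:ℝ) ∂μ)) := by
    refine tendsto_integral_of_dominated_convergence (fun _ => (1:ℝ))
      (fun k => (aux_integrable μ hT (hTk k)).aestronglyMeasurable) (integrable_const _) ?_ ?_
    · intro k
      refine Eventually.of_forall fun z => ?_
      have h0 : (0:ℝ) ≤ min (1:ℝ) ‖T z - Tk k z‖ := le_min zero_le_one (norm_nonneg _)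
      rw [Real.norm_of_nonneg h0]
      exact min_le_left _ _
    · refine Eventually.of_forall fun z => ?_
      refine tendsto_const_nhds.congr' ?_
      obtain ⟨N, hN⟩ := exists_nat_ge ‖T z‖
      filter_upwards [eventually_ge_atTop N] with k hk
      have : z ∈ {z | ‖T z‖ ≤ k} := hN.trans (by exact_mod_cast hk)
      simp [Tk, Set.indicator_of_mem this]
  rw [integral_zero] at hlim
  obtain ⟨k, hk⟩ := (hlim.eventually (gt_mem_nhds (half_pos hε))).exists
  have hint : Integrable (Tk k) μ := by
    refine Integrable.of_bound (C := k) (hTk k).aestronglyMeasurable ?_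
    refine Eventually.of_forall fun z => ?_
    by_cases h : z ∈ {z | ‖T z‖ ≤ k}
    · simp only [Tk, Set.indicator_of_mem h]; exact h
    · simp [Tk, Set.indicator_of_notMem h]
  obtain ⟨g, hg, hgi⟩ := hint.exists_boundedContinuous_integral_sub_le (half_pos hε)
  refine ⟨g, g.continuous, ?_⟩
  have hgm := g.continuous.measurable
  calc ∫ z, min (1:ℝ) ‖T z - g z‖ ∂μ
      ≤ ∫ z, (min (1:ℝ) ‖T z - Tk k z‖ + ‖Tk k z - g z‖) ∂μ := by
        refine integral_mono (aux_integrable μ hT hgm)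
          ((aux_integrable μ hT (hTk k)).add (hint.sub hgi).norm) fun z => ?_
        exact (aux_tri _ (Tk k z) _).trans (by gcongr; exact min_le_right _ _)
    _ = _ := integral_add (aux_integrable μ hT (hTk k)) (hint.sub hgi).norm
    _ < ε := by linarith

/-- For Borel measurable maps `Tₙ, T : ℝ^d → ℝ^m` and a Borel probability
measure `μ` on `ℝ^d`, the pushforwards `(Id × Tₙ)♯μ` converge weakly to `(Id × T)♯μ` if and
only if `Tₙ → T` in `μ`-measure. -/
theorem stmt15 {d m : ℕ}
    (μ : Measure (EuclideanSpace ℝ (Fin d))) [IsProbabilityMeasure μ]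
    (Tn : ℕ → EuclideanSpace ℝ (Fin d) → EuclideanSpace ℝ (Fin m))
    (T : EuclideanSpace ℝ (Fin d) → EuclideanSpace ℝ (Fin m))
    (hTn : ∀ n, Measurable (Tn n)) (hT : Measurable T) :
    (∀ f : BoundedContinuousFunction (EuclideanSpace ℝ (Fin d) × EuclideanSpace ℝ (Fin m)) ℝ,
      Tendsto (fun n => ∫ p, f p ∂(μ.map fun z => (z, Tn n z))) atTop
        (nhds (∫ p, f p ∂(μ.map fun z => (z, T z))))) ↔
    TendstoInMeasure μ Tn atTop T := by
  have hmap : ∀ (A : EuclideanSpace ℝ (Fin d) → EuclideanSpace ℝ (Fin m)) (_ : Measurable A)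
      (f : BoundedContinuousFunction (EuclideanSpace ℝ (Fin d) × EuclideanSpace ℝ (Fin m)) ℝ),
      ∫ p, f p ∂(μ.map fun z => (z, A z)) = ∫ z, f (z, A z) ∂μ := fun A hA f =>
    integral_map (measurable_id.prodMk hA).aemeasurable
      f.continuous.measurable.aestronglyMeasurable
  constructor
  · intro h
    have key : Tendsto (fun n => ∫ z, min (1:ℝ) ‖Tn n z - T z‖ ∂μ) atTop (nhds 0) := by
      have hnn : ∀ n, 0 ≤ ∫ z, min (1:ℝ) ‖Tn n z - T z‖ ∂μ := fun n =>
        integral_nonneg fun z => le_min zero_le_one (norm_nonneg _)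
      rw [Metric.tendsto_atTop]
      intro ε hε
      obtain ⟨S, hS, hSε⟩ := aux_approx μ T hT (ε / 2) (half_pos hε)
      let f : BoundedContinuousFunction
          (EuclideanSpace ℝ (Fin d) × EuclideanSpace ℝ (Fin m)) ℝ :=
        BoundedContinuousFunction.ofNormedAddCommGroup
          (fun p => min (1:ℝ) ‖p.2 - S p.1‖) (by fun_prop) 1 (by
            intro p
            have h0 : (0:ℝ) ≤ min (1:ℝ) ‖p.2 - S p.1‖ := le_min zero_le_one (norm_nonneg _)
            rw [Real.norm_of_nonneg h0]
            exact min_le_left _ _)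
      have hf := h f
      rw [hmap T hT] at hf
      simp only [hmap _ (hTn _)] at hf
      change Tendsto (fun n => ∫ z, min (1:ℝ) ‖Tn n z - S z‖ ∂μ) atTop
        (nhds (∫ z, min (1:ℝ) ‖T z - S z‖ ∂μ)) at hf
      obtain ⟨N, hN⟩ := eventually_atTop.1 (hf.eventually (gt_mem_nhds hSε))
      refine ⟨N, fun n hn => ?_⟩
      rw [Real.dist_eq, sub_zero, abs_of_nonneg (hnn n)]
      have h1 := hN n hn
      have hSm := hS.measurable
      calc ∫ z, min (1:ℝ) ‖Tn n z - T z‖ ∂μ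
          ≤ ∫ z, (min (1:ℝ) ‖Tn n z - S z‖ + min (1:ℝ) ‖T z - S z‖) ∂μ := by
            refine integral_mono (aux_integrable μ (hTn n) hT)
              ((aux_integrable μ (hTn n) hSm).add (aux_integrable μ hT hSm)) fun z => ?_
            have := aux_tri (Tn n z) (S z) (T z)
            rwa [norm_sub_rev (S z)] at this
        _ = _ := integral_add (aux_integrable μ (hTn n) hSm) (aux_integrable μ hT hSm)
        _ < ε := by linarith
    rw [tendstoInMeasure_iff_measureReal_norm]
    intro η hη
    have hc : (0:ℝ) < min 1 η := lt_min one_pos hη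
    have key2 := key.const_mul (min 1 η)⁻¹
    rw [mul_zero] at key2
    refine squeeze_zero (fun n => measureReal_nonneg) (fun n => ?_) key2
    have hM := mul_meas_ge_le_integral_of_nonneg (μ := μ)
      (Eventually.of_forall fun z => le_min zero_le_one (norm_nonneg (Tn n z - T z)))
      (aux_integrable μ (hTn n) hT) (min 1 η)
    rw [inv_mul_eq_div, le_div_iff₀' hc]
    refine le_trans ?_ hM
    refine mul_le_mul_of_nonneg_left (measureReal_mono ?_) hc.le
    intro z hz
    have hz2 : η ≤ ‖Tn n z - T z‖ := hz
    exact min_le_min (le_refl (1:ℝ)) hz2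
  · intro h f
    rw [hmap T hT]
    simp only [hmap _ (hTn _)]
    refine tendsto_of_subseq_tendsto fun ns hns => ?_
    obtain ⟨ms, -, hms⟩ := (h.comp hns).exists_seq_tendsto_ae
    refine ⟨ms, ?_⟩
    refine tendsto_integral_of_dominated_convergence (fun _ => ‖f‖)
      (fun k => (f.continuous.measurable.comp
        (measurable_id.prodMk (hTn _))).aestronglyMeasurable) (integrable_const _) ?_ ?_
    · exact fun k => Eventually.of_forall fun z => f.norm_coe_le_norm _
    · filter_upwards [hms] with z hz
      exact (f.continuous.tendsto _).comp (tendsto_const_nhds.prodMk_nhds hz)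

end
end

section
/- Tweedie's formula: let ξ be a σ-finite Borel measure on ℝ^d and w : ℝ^d → [0,∞) measurable with w not ξ-a.e. zero, and set M(z) := ∫ e^{⟨θ, z⟩} w(θ) dξ(θ) and κ(z) := log M(z). If z₀ lies in the interior of the set D := {z ∈ ℝ^d : M(z) < ∞}, then M is differentiable at z₀ with ∇M(z₀) = ∫ θ e^{⟨θ, z₀⟩} w(θ) dξ(θ) (the integral being absolutely convergent), and consequently the posterior mean of the exponential-family model satisfies (∫ θ e^{⟨θ, z₀⟩} w(θ) dξ(θ)) / M(z₀) = ∇κ(z₀). -/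
open MeasureTheory RealInnerProductSpace
open scoped ENNReal

noncomputable section

/-- Exponentials of the norm are dominated by finitely many exponentials of coordinates. -/
lemma exp_norm_le_aux {d : ℕ} (c : ℝ) (hc : 0 ≤ c) (θ : EuclideanSpace ℝ (Fin d)) :
    Real.exp (c * ‖θ‖) ≤ 1 + ∑ i : Fin d,
      (Real.exp (c * d * θ i) + Real.exp (-(c * d * θ i))) := by
  have hn : ‖θ‖ ≤ ∑ i, |θ i| := by
    rw [EuclideanSpace.norm_eq]
    refine Real.sqrt_le_iff.2 ⟨Finset.sum_nonneg fun i _ => abs_nonneg _, ?_⟩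
    simp only [Real.norm_eq_abs]
    exact Finset.sum_sq_le_sq_sum_of_nonneg (fun i _ => abs_nonneg _)
  rcases isEmpty_or_nonempty (Fin d) with h | h
  · simp at hn
    simp [hn]
  · obtain ⟨i, -, hi⟩ := Finset.exists_max_image Finset.univ (fun i => |θ i|) Finset.univ_nonempty
    have h1 : ‖θ‖ ≤ d * |θ i| := by
      refine hn.trans ((Finset.sum_le_card_nsmul _ _ _ hi).trans ?_)
      simp
    have h2 : Real.exp (c * ‖θ‖) ≤ Real.exp (c * d * θ i) + Real.exp (-(c * d * θ i)) := by
      have : c * ‖θ‖ ≤ |c * d * θ i| := by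
        rw [abs_mul, abs_of_nonneg (by positivity : (0:ℝ) ≤ c * d), mul_assoc]
        gcongr
      refine (Real.exp_le_exp.2 this).trans ?_
      exact Real.exp_abs_le _
    have h3 := Finset.single_le_sum
      (f := fun i : Fin d => Real.exp (c * d * θ i) + Real.exp (-(c * d * θ i)))
      (fun i _ => by positivity) (Finset.mem_univ i)
    dsimp only at h3
    linarith

/-- **Tweedie's formula.** Let `ξ` be a σ-finite Borel measure on `ℝ^d`,
`w ≥ 0` measurable and not `ξ`-a.e. zero, and `M(z) = ∫ e^{⟨θ,z⟩} w(θ) dξ(θ)`,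
`κ = log M`. If `z₀` lies in the interior of `D = {M < ∞}`, then `M` is differentiable at
`z₀` with gradient `∫ θ e^{⟨θ,z₀⟩} w(θ) dξ(θ)` (an absolutely convergent integral), and the
posterior mean satisfies `(∫ θ e^{⟨θ,z₀⟩} w dξ)/M(z₀) = ∇κ(z₀)`. -/
theorem stmt18 {d : ℕ}
    (ξ : Measure (EuclideanSpace ℝ (Fin d))) [SigmaFinite ξ]
    (w : EuclideanSpace ℝ (Fin d) → ℝ)
    (hw_meas : Measurable w) (hw_nonneg : ∀ θ, 0 ≤ w θ)
    (hw_ne : ¬ (w =ᵐ[ξ] 0))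
    (M : EuclideanSpace ℝ (Fin d) → ℝ≥0∞)
    (hM : M = fun z => ∫⁻ θ, ENNReal.ofReal (Real.exp ⟪θ, z⟫ * w θ) ∂ξ)
    (z₀ : EuclideanSpace ℝ (Fin d))
    (hz₀ : z₀ ∈ interior {z | M z < ⊤}) :
    Integrable (fun θ => (Real.exp ⟪θ, z₀⟫ * w θ) • θ) ξ ∧
    HasGradientAt (fun z => (M z).toReal)
      (∫ θ, (Real.exp ⟪θ, z₀⟫ * w θ) • θ ∂ξ) z₀ ∧
    HasGradientAt (fun z => Real.log (M z).toReal)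
      ((M z₀).toReal⁻¹ • ∫ θ, (Real.exp ⟪θ, z₀⟫ * w θ) • θ ∂ξ) z₀ := by
  have hmeas : ∀ z : EuclideanSpace ℝ (Fin d),
      Measurable (fun θ : EuclideanSpace ℝ (Fin d) => Real.exp ⟪θ, z⟫ * w θ) := by
    intro z
    exact (by fun_prop : Measurable fun θ : EuclideanSpace ℝ (Fin d) => Real.exp ⟪θ, z⟫).mul hw_meas
  have hnn : ∀ z θ : EuclideanSpace ℝ (Fin d), 0 ≤ Real.exp ⟪θ, z⟫ * w θ :=
    fun z θ => mul_nonneg (Real.exp_pos _).le (hw_nonneg θ)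
  have hMr : (fun z => (M z).toReal) = fun z => ∫ θ, Real.exp ⟪θ, z⟫ * w θ ∂ξ := by
    funext z
    rw [hM, integral_eq_lintegral_of_nonneg_ae (Filter.Eventually.of_forall (hnn z))
      (hmeas z).aestronglyMeasurable]
  have hint : ∀ z, M z < ⊤ → Integrable (fun θ => Real.exp ⟪θ, z⟫ * w θ) ξ := by
    intro z hz
    refine ⟨(hmeas z).aestronglyMeasurable, ?_⟩
    rw [hasFiniteIntegral_iff_ofReal (Filter.Eventually.of_forall (hnn z))]
    rw [hM] at hz
    exact hz
  obtain ⟨ε, hε, hball⟩ := Metric.mem_nhds_iff.1 (mem_interior_iff_mem_nhds.1 hz₀)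
  have hI : ∀ v : EuclideanSpace ℝ (Fin d), ‖v‖ < ε →
      Integrable (fun θ => Real.exp ⟪θ, z₀ + v⟫ * w θ) ξ := by
    intro v hv
    exact hint _ (hball (by simpa using hv))
  obtain ⟨c, hc, hcd⟩ : ∃ c : ℝ, 0 < c ∧ c * d < ε := by
    refine ⟨ε / (d + 1), by positivity, ?_⟩
    rw [div_mul_eq_mul_div, div_lt_iff₀ (by positivity)]
    nlinarith
  have hcoord : ∀ t : ℝ, |t| < ε → ∀ i : Fin d,
      Integrable (fun θ => Real.exp ⟪θ, z₀⟫ * w θ * Real.exp (t * θ i)) ξ := by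
    intro t ht i
    refine (hI (EuclideanSpace.single i t) (by simpa using ht)).congr
      (Filter.Eventually.of_forall fun θ => ?_)
    simp only [inner_add_right, Real.exp_add, EuclideanSpace.inner_single_right]
    simp
    ring
  have habs : |c * d| < ε := by rwa [abs_of_nonneg (by positivity)]
  have hz₀int : Integrable (fun θ => Real.exp ⟪θ, z₀⟫ * w θ) ξ := by simpa using hI 0 (by simpa using hε)
  have hdom : Integrable (fun θ => Real.exp ⟪θ, z₀⟫ * w θ * Real.exp (c * ‖θ‖)) ξ := by
    have hg : Integrable (fun θ : EuclideanSpace ℝ (Fin d) => Real.exp ⟪θ, z₀⟫ * w θ + ∑ i : Fin d,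
        (Real.exp ⟪θ, z₀⟫ * w θ * Real.exp (c * d * θ i)
          + Real.exp ⟪θ, z₀⟫ * w θ * Real.exp (-(c * d) * θ i))) ξ := by
      refine hz₀int.add (integrable_finsetSum _ fun i _ => ?_)
      exact (hcoord _ habs i).add (hcoord _ (by rwa [abs_neg]) i)
    refine hg.mono' ?_ (Filter.Eventually.of_forall fun θ => ?_)
    · exact ((hmeas z₀).mul (by fun_prop)).aestronglyMeasurable
    · rw [Real.norm_of_nonneg (mul_nonneg (hnn _ _) (Real.exp_pos _).le)]
      refine (mul_le_mul_of_nonneg_left (exp_norm_le_aux c hc.le θ) (hnn z₀ θ)).trans_eq ?_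
      rw [mul_add, mul_one, Finset.mul_sum]
      simp only [mul_add, neg_mul]
  have hbd : ∀ θ : EuclideanSpace ℝ (Fin d), ∀ z ∈ Metric.ball z₀ (c / 2),
      Real.exp ⟪θ, z⟫ * w θ * ‖θ‖ ≤ (2 / c) * (Real.exp ⟪θ, z₀⟫ * w θ * Real.exp (c * ‖θ‖)) := by
    intro θ z hz
    rw [Metric.mem_ball, dist_eq_norm] at hz
    have h1 : ⟪θ, z⟫ ≤ ⟪θ, z₀⟫ + c / 2 * ‖θ‖ := by
      have h := real_inner_le_norm θ (z - z₀)
      rw [inner_sub_right] at h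
      nlinarith [norm_nonneg θ]
    have h2 : ‖θ‖ ≤ 2 / c * Real.exp (c / 2 * ‖θ‖) := by
      have h := Real.add_one_le_exp (c / 2 * ‖θ‖)
      calc ‖θ‖ = 2 / c * (c / 2 * ‖θ‖) := by field_simp
        _ ≤ _ := by gcongr; linarith
    calc Real.exp ⟪θ, z⟫ * w θ * ‖θ‖
        ≤ Real.exp (⟪θ, z₀⟫ + c / 2 * ‖θ‖) * w θ * (2 / c * Real.exp (c / 2 * ‖θ‖)) := by
          have := hw_nonneg θ
          gcongr
      _ = _ := by
          rw [show c * ‖θ‖ = c / 2 * ‖θ‖ + c / 2 * ‖θ‖ by ring, Real.exp_add, Real.exp_add]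
          ring
  have hvm : ∀ z : EuclideanSpace ℝ (Fin d),
      AEStronglyMeasurable (fun θ : EuclideanSpace ℝ (Fin d) => (Real.exp ⟪θ, z⟫ * w θ) • θ) ξ :=
    fun z => ((hmeas z).smul measurable_id).aestronglyMeasurable
  have hvi : Integrable (fun θ => (Real.exp ⟪θ, z₀⟫ * w θ) • θ) ξ := by
    refine (hdom.const_mul (2 / c)).mono' (hvm z₀) (Filter.Eventually.of_forall fun θ => ?_)
    rw [norm_smul, Real.norm_of_nonneg (hnn _ _)]
    exact hbd θ z₀ (Metric.mem_ball_self (by positivity))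
  have hder : HasFDerivAt (fun z => ∫ θ, Real.exp ⟪θ, z⟫ * w θ ∂ξ)
      (∫ θ, innerSL ℝ ((Real.exp ⟪θ, z₀⟫ * w θ) • θ) ∂ξ) z₀ := by
    refine hasFDerivAt_integral_of_dominated_of_fderiv_le
      (F' := fun z θ => innerSL ℝ ((Real.exp ⟪θ, z⟫ * w θ) • θ))
      (bound := fun θ => (2 / c) * (Real.exp ⟪θ, z₀⟫ * w θ * Real.exp (c * ‖θ‖)))
      (Metric.ball_mem_nhds z₀ (by positivity : 0 < c / 2))
      (Filter.Eventually.of_forall fun z => (hmeas z).aestronglyMeasurable) hz₀int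
      ((innerSL ℝ).continuous.comp_aestronglyMeasurable (hvm z₀))
      (Filter.Eventually.of_forall fun θ z hz => ?_) (hdom.const_mul _)
      (Filter.Eventually.of_forall fun θ z hz => ?_)
    · rw [innerSL_apply_norm, norm_smul, Real.norm_of_nonneg (hnn _ _)]
      exact hbd θ z hz
    · have h := ((innerSL ℝ θ).hasFDerivAt (x := z)).exp.mul_const (w θ)
      refine h.congr_fderiv ?_
      ext v
      simp [inner_smul_left]
      ring
  have hgrad : HasGradientAt (fun z => (M z).toReal)
      (∫ θ, (Real.exp ⟪θ, z₀⟫ * w θ) • θ ∂ξ) z₀ := by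
    rw [hasGradientAt_iff_hasFDerivAt, hMr]
    refine hder.congr_fderiv ?_
    rw [(innerSL ℝ).integral_comp_comm hvi]
    rfl
  refine ⟨hvi, hgrad, ?_⟩
  have hpos : (M z₀).toReal ≠ 0 := by
    rw [congrFun hMr z₀]
    intro h0
    rw [integral_eq_zero_iff_of_nonneg (hnn z₀) hz₀int] at h0
    apply hw_ne
    filter_upwards [h0] with θ hθ
    simpa [Real.exp_ne_zero] using hθ
  rw [hasGradientAt_iff_hasFDerivAt] at hgrad ⊢
  refine (hgrad.log hpos).congr_fderiv ?_
  simp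

end
end
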